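/- Let (R,n) be a Noetherian local ring and let x_1,…,x_m, y_1,…,y_k ∈ n be a regular sequence on R. Set I = (x_1,…,x_m) and J = (y_1,…,y_k). Then Tor_1^R(R/I^i, R/J^j) = 0 for all i, j ≥ 0; in particular Tor_1^R(R/I, R/J) = 0. -/

import Mathlib

open CategoryTheory

section RegularFamily

variable {R ι : Type*} [CommRing R]

/-- A family is permutably regular if each member is regular modulo the ideal generated by any
finite set of other members. -/
def IsPermutablyRegular (z : ι → R) : Prop :=
  ∀ (s : Finset ι) (u : ι), u ∉ s → ∀ p : R,
    z u * p ∈ Ideal.span (z '' s) → p ∈ Ideal.span (z '' s)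

lemma span_image_insert [DecidableEq ι] (z : ι → R) (v : ι) (s : Finset ι) :
    Ideal.span (z '' (insert v s : Finset ι)) = Ideal.span {z v} ⊔ Ideal.span (z '' s) := by
  rw [Finset.coe_insert, Set.image_insert_eq, Ideal.span_insert]

lemma Ideal.sup_pow_succ_le (a b : Ideal R) (j : ℕ) :
    (a ⊔ b) ^ (j + 1) ≤ a * (a ⊔ b) ^ j ⊔ b ^ (j + 1) := by
  induction j with
  | zero => simp
  | succ j ih =>
    calc (a ⊔ b) ^ (j + 1 + 1) = a * (a ⊔ b) ^ (j + 1) ⊔ b * (a ⊔ b) ^ (j + 1) := by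
          rw [pow_succ' _ (j + 1), Ideal.sup_mul]
      _ ≤ a * (a ⊔ b) ^ (j + 1) ⊔ b ^ (j + 1 + 1) := by
          refine sup_le le_sup_left ((Ideal.mul_mono_right ih).trans ?_)
          rw [Ideal.mul_sup, ← pow_succ']
          refine sup_le_sup_right ?_ _
          rw [mul_left_comm]
          refine Ideal.mul_mono_right ?_
          rw [pow_succ']
          exact Ideal.mul_mono_left le_sup_right

/-- An element of `(v, I)ʲ⁺¹ + L` is the sum of a multiple of `v` by an element of `(v, I)ʲ` and
an element of `Iʲ⁺¹ + L`. -/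
lemma exists_mul_add_of_mem_pow_succ_sup {v a : R} {I L : Ideal R} {j : ℕ}
    (ha : a ∈ (Ideal.span {v} ⊔ I) ^ (j + 1) ⊔ L) :
    ∃ w ∈ (Ideal.span {v} ⊔ I) ^ j, ∃ b ∈ I ^ (j + 1) ⊔ L, v * w + b = a := by
  have h := sup_le_sup_right (Ideal.sup_pow_succ_le (Ideal.span {v}) I j) L ha
  rw [sup_assoc] at h
  obtain ⟨c, hc, b, hb, rfl⟩ := Submodule.mem_sup.mp h
  obtain ⟨w, hw, rfl⟩ := Ideal.mem_span_singleton_mul.mp hc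
  exact ⟨w, hw, b, hb, rfl⟩

lemma pow_succ_sup_le {I K L : Ideal R} {j : ℕ} : I ^ (j + 1) ⊔ L ≤ (K ⊔ I) ^ j ⊔ L :=
  sup_le_sup_right (α := Ideal R) ((Ideal.pow_le_pow_right j.le_succ).trans
    (Ideal.pow_right_mono le_sup_right _)) _

lemma mul_mem_pow_succ_sup {v w : R} {I L : Ideal R} {j : ℕ}
    (hw : w ∈ (Ideal.span {v} ⊔ I) ^ j ⊔ L) :
    v * w ∈ (Ideal.span {v} ⊔ I) ^ (j + 1) ⊔ L := by
  obtain ⟨c, hc, l, hl, rfl⟩ := Submodule.mem_sup.mp hw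
  rw [mul_add]
  refine Submodule.add_mem_sup ?_ (L.mul_mem_left _ hl)
  rw [pow_succ']
  exact Ideal.mul_mem_mul (Ideal.mem_sup_left (Ideal.mem_span_singleton_self v)) hc

namespace IsPermutablyRegular

variable [DecidableEq ι] {z : ι → R}

lemma mem_pow_sup_of_mul_mem (hz : IsPermutablyRegular z) (s t : Finset ι) (u : ι)
    (hst : Disjoint s t) (hus : u ∉ s) (hut : u ∉ t) (j : ℕ) (p : R)
    (hp : z u * p ∈ Ideal.span (z '' s) ^ j ⊔ Ideal.span (z '' t)) :
    p ∈ Ideal.span (z '' s) ^ j ⊔ Ideal.span (z '' t) := by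
  induction s using Finset.induction generalizing t u j p with
  | empty =>
    rcases j with _ | j
    · simp
    · simp only [Finset.coe_empty, Set.image_empty, Ideal.span_empty, ← Ideal.zero_eq_bot,
        zero_pow (Nat.succ_ne_zero j), zero_add, ← Submodule.add_eq_sup] at hp ⊢
      exact hz t u hut p hp
  | insert v s hvs ih =>
    simp only [Finset.disjoint_insert_left, Finset.mem_insert, not_or] at hst hus
    induction j generalizing p with
    | zero => simp
    | succ j ihj =>
      rw [span_image_insert] at hp ihj ⊢
      have hle : Ideal.span (z '' s) ^ (j + 1) ⊔ Ideal.span (z '' t) ≤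
          (Ideal.span {z v} ⊔ Ideal.span (z '' s)) ^ (j + 1) ⊔ Ideal.span (z '' t) :=
        sup_le_sup_right (Ideal.pow_right_mono le_sup_right _) _
      have hp' : p ∈ Ideal.span (z '' s) ^ (j + 1) ⊔
          Ideal.span (z '' (insert v t : Finset ι)) := by
        refine ih _ u ?_ hus.2 (by simp [hus.1, hut]) _ _ ?_
        · simp [hvs, hst.2]
        · obtain ⟨w, -, b, hb, h⟩ := exists_mul_add_of_mem_pow_succ_sup hp
          rw [← h, span_image_insert, sup_left_comm]
          exact Submodule.add_mem_sup (Ideal.mul_mem_right _ _ (Ideal.mem_span_singleton_self _)) hb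
      rw [span_image_insert, sup_left_comm] at hp'
      obtain ⟨c, hc, q, hq, rfl⟩ := Submodule.mem_sup.mp hp'
      obtain ⟨r, rfl⟩ := Ideal.mem_span_singleton'.mp hc
      have hq' := hle hq
      refine add_mem ?_ hq'
      rw [mul_comm r]
      refine mul_mem_pow_succ_sup (ihj r ?_)
      rw [mul_add] at hp
      have h := (Submodule.add_mem_iff_left _ (Ideal.mul_mem_left _ (z u) hq')).mp hp
      obtain ⟨w, hw, b, hb, h⟩ := exists_mul_add_of_mem_pow_succ_sup h
      have hr : z u * r - w ∈ Ideal.span (z '' s) ^ (j + 1) ⊔ Ideal.span (z '' t) := by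
        refine ih t v hst.2 hvs hst.1 _ _ ?_
        convert hb using 1
        linear_combination -h
      rw [← sub_add_cancel (z u * r) w]
      refine add_mem ?_ (Ideal.mem_sup_left hw)
      exact pow_succ_sup_le hr

lemma pow_inf_span_le_mul (hz : IsPermutablyRegular z) (s t : Finset ι) (hst : Disjoint s t)
    (i : ℕ) :
    Ideal.span (z '' s) ^ i ⊓ Ideal.span (z '' t) ≤
      Ideal.span (z '' s) ^ i * Ideal.span (z '' t) := by
  induction t using Finset.induction with
  | empty => simp
  | insert v t hvt ih =>
    simp only [Finset.disjoint_insert_right] at hst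
    rintro a ⟨haA, hat⟩
    rw [SetLike.mem_coe, span_image_insert] at hat
    obtain ⟨c, hc, y, hy, rfl⟩ := Submodule.mem_sup.mp hat
    obtain ⟨r, rfl⟩ := Ideal.mem_span_singleton'.mp hc
    have hr : r ∈ Ideal.span (z '' s) ^ i ⊔ Ideal.span (z '' t) := by
      refine hz.mem_pow_sup_of_mul_mem s t v hst.2 hst.1 hvt i r ?_
      rw [show z v * r = (r * z v + y) - y by ring]
      exact sub_mem (Ideal.mem_sup_left haA) (Ideal.mem_sup_right hy)
    obtain ⟨a, ha, y', hy', rfl⟩ := Submodule.mem_sup.mp hr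
    have h : y' * z v + y ∈ Ideal.span (z '' s) ^ i * Ideal.span (z '' t) := by
      refine ih hst.2 ⟨?_, add_mem (Ideal.mul_mem_right _ _ hy') hy⟩
      rw [SetLike.mem_coe] at haA ⊢
      convert sub_mem haA (Ideal.mul_mem_right (z v) _ ha) using 1
      ring
    rw [show (a + y') * z v + y = a * z v + (y' * z v + y) by ring, span_image_insert, Ideal.mul_sup]
    exact Submodule.add_mem_sup (Ideal.mul_mem_mul ha (Ideal.mem_span_singleton_self _)) h

lemma pow_inf_pow_sup_le_mul (hz : IsPermutablyRegular z) (s t l : Finset ι) (hst : Disjoint s t)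
    (hsl : Disjoint s l) (htl : Disjoint t l) (i j : ℕ) :
    Ideal.span (z '' s) ^ i ⊓ (Ideal.span (z '' t) ^ j ⊔ Ideal.span (z '' l)) ≤
      Ideal.span (z '' s) ^ i * (Ideal.span (z '' t) ^ j ⊔ Ideal.span (z '' l)) := by
  induction t using Finset.induction generalizing l j with
  | empty =>
    rcases j with _ | j
    · simp
    · simp only [Finset.coe_empty, Set.image_empty, Ideal.span_empty, ← Ideal.zero_eq_bot,
        zero_pow (Nat.succ_ne_zero j), zero_add, ← Submodule.add_eq_sup]
      exact hz.pow_inf_span_le_mul s l hsl i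
  | insert v t hvt ih =>
    simp only [Finset.disjoint_insert_right, Finset.disjoint_insert_left] at hst htl
    induction j with
    | zero => simp
    | succ j ihj =>
      have hcolon := hz.mem_pow_sup_of_mul_mem t l v htl.2 hvt htl.1 (j + 1)
      rw [span_image_insert] at ihj ⊢
      have hle : Ideal.span (z '' t) ^ (j + 1) ⊔ Ideal.span (z '' l) ≤
          (Ideal.span {z v} ⊔ Ideal.span (z '' t)) ^ (j + 1) ⊔ Ideal.span (z '' l) :=
        sup_le_sup_right (Ideal.pow_right_mono le_sup_right _) _
      rintro a ⟨haA, ha⟩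
      obtain ⟨w, hw, b, hb, hwb⟩ := exists_mul_add_of_mem_pow_succ_sup ha
      have ha' := ih (insert v l) hst.2 (by simp [hst.1, hsl]) (by simp [hvt, htl.2]) (j + 1)
        ⟨haA, by
          rw [SetLike.mem_coe, ← hwb, span_image_insert, sup_left_comm]
          exact Submodule.add_mem_sup
            (Ideal.mul_mem_right _ _ (Ideal.mem_span_singleton_self _)) hb⟩
      rw [span_image_insert, sup_left_comm, Ideal.mul_sup] at ha'
      obtain ⟨e, he, f, hf, hef⟩ := Submodule.mem_sup.mp ha'
      obtain ⟨c, hc, rfl⟩ := Ideal.mem_mul_span_singleton.mp he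
      have hc' : c ∈ (Ideal.span {z v} ⊔ Ideal.span (z '' t)) ^ j ⊔ Ideal.span (z '' l) := by
        have h : c - w ∈ Ideal.span (z '' t) ^ (j + 1) ⊔ Ideal.span (z '' l) := by
          refine hcolon _ ?_
          have hf' : f ∈ Ideal.span (z '' t) ^ (j + 1) ⊔ Ideal.span (z '' l) :=
            Ideal.mul_le_right hf
          have h : z v * (c - w) = b - f := by linear_combination hef - hwb
          rw [h]
          exact sub_mem hb hf'
        rw [← sub_add_cancel c w]
        refine add_mem ?_ (Ideal.mem_sup_left hw)
        exact pow_succ_sup_le h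
      rw [← hef]
      refine add_mem ?_ (Ideal.mul_mono_right hle hf)
      have hmul : Ideal.span {z v} *
          ((Ideal.span {z v} ⊔ Ideal.span (z '' t)) ^ j ⊔ Ideal.span (z '' l)) ≤
          (Ideal.span {z v} ⊔ Ideal.span (z '' t)) ^ (j + 1) ⊔ Ideal.span (z '' l) := by
        intro r hr
        obtain ⟨q, hq, rfl⟩ := Ideal.mem_span_singleton_mul.mp hr
        exact mul_mem_pow_succ_sup hq
      refine Ideal.mul_mono_right hmul ?_
      rw [mul_left_comm, mul_comm c]
      exact Ideal.mul_mem_mul (Ideal.mem_span_singleton_self _) (ihj ⟨hc, hc'⟩)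

end IsPermutablyRegular

open RingTheory.Sequence in
/-- In a Noetherian local ring a regular sequence is permutably regular. -/
lemma IsPermutablyRegular.of_isWeaklyRegular [IsNoetherianRing R] [IsLocalRing R] [Fintype ι]
    [DecidableEq ι] {z : ι → R} (hmem : ∀ u, z u ∈ IsLocalRing.maximalIdeal R) {l : List ι}
    (hl : l.Perm Finset.univ.toList) (h : IsWeaklyRegular R (l.map z)) :
    IsPermutablyRegular z := by
  intro s u hu p hp
  have hperm : l.Perm (s.toList ++ u :: (Finset.univ \ insert u s).toList) := by
    refine hl.trans ((List.perm_ext_iff_of_nodup (Finset.nodup_toList _) ?_).mpr ?_)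
    · simp only [List.nodup_append, List.nodup_cons, Finset.nodup_toList, Finset.mem_toList,
        List.mem_cons]
      grind
    · simp only [Finset.mem_toList, List.mem_append, List.mem_cons]
      grind
  have h' := IsLocalRing.isWeaklyRegular_of_perm_of_subset_maximalIdeal h (hperm.map z)
    (by simp only [List.mem_map]; rintro _ ⟨v, -, rfl⟩; exact hmem v)
  rw [List.map_append, isWeaklyRegular_append_iff, List.map_cons, isWeaklyRegular_cons_iff] at h'
  have hreg := h'.2.1
  have hs : Ideal.ofList (s.toList.map z) = Ideal.span (z '' s) := by
    unfold Ideal.ofList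
    congr 1
    ext
    simp
  rw [hs, smul_eq_mul, Ideal.mul_top] at hreg
  rw [← Ideal.Quotient.eq_zero_iff_mem] at hp ⊢
  apply hreg
  simpa [Algebra.smul_def] using hp

end RegularFamily

section TorOne

lemma mem_smul_ker_of_inf_le_mul {R P : Type*} [CommRing R] [AddCommGroup P] [Module R P]
    [Module.Projective R P] {A B : Ideal R} (hAB : A ⊓ B ≤ A * B) {ε : P →ₗ[R] R ⧸ B}
    (hε : Function.Surjective ε) {p : P} (hpA : p ∈ A • (⊤ : Submodule R P)) (hp : ε p = 0) :
    p ∈ A • LinearMap.ker ε := by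
  obtain ⟨φ, hφ⟩ := Module.projective_lifting_property B.mkQ ε B.mkQ_surjective
  obtain ⟨e, he⟩ := hε (B.mkQ 1)
  have hφ' (q : P) : B.mkQ (φ q) = ε q := LinearMap.congr_fun hφ q
  have hεe (r : R) : ε (r • e) = B.mkQ r := by
    rw [map_smul, he, ← map_smul, smul_eq_mul, mul_one]
  have hφp : φ p ∈ A * B := by
    refine hAB ⟨?_, ?_⟩
    · have := Submodule.mem_map_of_mem (f := φ) hpA
      rw [Submodule.map_smul'', smul_eq_mul] at this
      exact Ideal.mul_le_left this
    · rw [SetLike.mem_coe, ← Submodule.Quotient.mk_eq_zero, ← Submodule.mkQ_apply, hφ', hp]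
  let ψ : P →ₗ[R] P := LinearMap.id - (LinearMap.toSpanSingleton R P e).comp φ
  have hψ (q : P) : ψ q = q - φ q • e := rfl
  have hψp : ψ p ∈ A • LinearMap.ker ε := by
    have := Submodule.mem_map_of_mem (f := ψ) hpA
    rw [Submodule.map_smul''] at this
    refine Submodule.smul_mono le_rfl ?_ this
    rintro _ ⟨q, -, rfl⟩
    rw [LinearMap.mem_ker, hψ, map_sub, hεe, hφ', sub_self]
  have hpe : φ p • e ∈ A • LinearMap.ker ε := by
    have := Submodule.mem_map_of_mem (f := LinearMap.toSpanSingleton R P e) hφp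
    rw [← smul_eq_mul, Submodule.map_smul''] at this
    refine Submodule.smul_mono le_rfl ?_ this
    rintro _ ⟨b, hb, rfl⟩
    rw [LinearMap.mem_ker, LinearMap.toSpanSingleton_apply, hεe, Submodule.mkQ_apply,
      Submodule.Quotient.mk_eq_zero]
    exact hb
  rw [← sub_add_cancel p (φ p • e)]
  exact add_mem hψp hpe

open TensorProduct in
lemma one_tmul_eq_zero_iff {R M : Type*} [CommRing R] [AddCommGroup M] [Module R M] (A : Ideal R)
    (p : M) : (1 : R ⧸ A) ⊗ₜ[R] p = 0 ↔ p ∈ A • (⊤ : Submodule R M) := by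
  rw [← (TensorProduct.quotTensorEquivQuotSMul M A).map_eq_zero_iff,
    ← map_one (Ideal.Quotient.mk A), TensorProduct.quotTensorEquivQuotSMul_mk_tmul, one_smul,
    Submodule.Quotient.mk_eq_zero]

open TensorProduct in
lemma lTensor_quotient_exact {R P₂ P₁ P₀ : Type*} [CommRing R] [AddCommGroup P₂] [Module R P₂]
    [AddCommGroup P₁] [Module R P₁] [AddCommGroup P₀] [Module R P₀] [Module.Projective R P₀]
    {A B : Ideal R} (hAB : A ⊓ B ≤ A * B) {f : P₂ →ₗ[R] P₁} {g : P₁ →ₗ[R] P₀}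
    {ε : P₀ →ₗ[R] R ⧸ B} (hfg : Function.Exact f g) (hgε : Function.Exact g ε)
    (hε : Function.Surjective ε) :
    Function.Exact (f.lTensor (R ⧸ A)) (g.lTensor (R ⧸ A)) := by
  refine fun t ↦ ⟨fun ht ↦ ?_, ?_⟩
  · obtain ⟨p, rfl⟩ : ∃ p : P₁, (1 : R ⧸ A) ⊗ₜ[R] p = t := by
      obtain ⟨q, rfl⟩ := (TensorProduct.quotTensorEquivQuotSMul P₁ A).symm.surjective t
      obtain ⟨p, rfl⟩ := Submodule.Quotient.mk_surjective _ q
      exact ⟨p, (TensorProduct.quotTensorEquivQuotSMul_symm_mk A p).symm⟩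
    rw [LinearMap.lTensor_tmul, one_tmul_eq_zero_iff] at ht
    have h := mem_smul_ker_of_inf_le_mul hAB hε ht (hgε.apply_apply_eq_zero p)
    rw [hgε.linearMap_ker_eq, ← Submodule.map_top, ← Submodule.map_smul''] at h
    obtain ⟨q, hq, hqp⟩ := h
    obtain ⟨r, hr⟩ := (hfg (p - q)).mp (by rw [map_sub, hqp, sub_self])
    refine ⟨1 ⊗ₜ r, ?_⟩
    rw [LinearMap.lTensor_tmul, hr, tmul_sub, (one_tmul_eq_zero_iff A q).mpr hq, sub_zero]
  · rintro ⟨s, rfl⟩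
    rw [← LinearMap.comp_apply, ← LinearMap.lTensor_comp, hfg.linearMap_comp_eq_zero,
      LinearMap.lTensor_zero, LinearMap.zero_apply]

/-- `Tor₁(R/A, R/B)` vanishes as soon as `A ∩ B = AB`. -/
lemma isZero_tor_one_quotient {R : Type} [CommRing R] {A B : Ideal R} (hAB : A ⊓ B ≤ A * B) :
    Limits.IsZero (((Tor (ModuleCat R) 1).obj (ModuleCat.of R (R ⧸ A))).obj
      (ModuleCat.of R (R ⧸ B))) := by
  let P := projectiveResolution (ModuleCat.of R (R ⧸ B))
  refine Limits.IsZero.of_iso ?_ (P.isoLeftDerivedObj _ 1)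
  refine (HomologicalComplex.exactAt_iff_isZero_homology _ _).mp ?_
  rw [HomologicalComplex.exactAt_iff' _ 2 1 0 (by simp) (by simp)]
  have h1 := P.exact_succ 0
  have h0 := P.exact₀
  rw [ShortComplex.ShortExact.moduleCat_exact_iff_function_exact] at h0 h1 ⊢
  have : Module.Projective R (P.complex.X 0) :=
    (IsProjective.iff_projective _).mpr (inferInstanceAs (Projective (P.complex.X 0)))
  exact lTensor_quotient_exact hAB h1 h0 ((ModuleCat.epi_iff_surjective (P.π.f 0)).mp inferInstance)

end TorOne

theorem stmt_14
    (R : Type) [CommRing R] [IsNoetherianRing R] [IsLocalRing R]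
    (m k : ℕ) (x : Fin m → R) (y : Fin k → R)
    -- x₁, …, x_m, y₁, …, y_k lie in the maximal ideal and form a regular sequence on R
    (hx : ∀ u, x u ∈ IsLocalRing.maximalIdeal R)
    (hy : ∀ u, y u ∈ IsLocalRing.maximalIdeal R)
    (hreg : RingTheory.Sequence.IsRegular R (List.ofFn x ++ List.ofFn y))
    (I J : Ideal R)
    (hI : I = Ideal.span (Set.range x)) (hJ : J = Ideal.span (Set.range y)) :
    (∀ i j : ℕ,
      Limits.IsZero (((Tor (ModuleCat R) 1).obj (ModuleCat.of R (R ⧸ I ^ i))).obj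
        (ModuleCat.of R (R ⧸ J ^ j)))) ∧
      Limits.IsZero (((Tor (ModuleCat R) 1).obj (ModuleCat.of R (R ⧸ I))).obj
        (ModuleCat.of R (R ⧸ J))) := by
  have hz : IsPermutablyRegular (Sum.elim x y) := by
    refine .of_isWeaklyRegular (l := (List.finRange m).map Sum.inl ++ (List.finRange k).map Sum.inr)
      (by rintro (u | u) <;> simp [hx, hy]) ?_ ?_
    · refine (List.perm_ext_iff_of_nodup ?_ (Finset.nodup_toList _)).mpr ?_
      · simp [List.nodup_append, List.nodup_map_iff Sum.inl_injective,
          List.nodup_map_iff Sum.inr_injective, List.nodup_finRange]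
      · rintro (u | u) <;> simp
    · convert hreg.toIsWeaklyRegular using 1
      simp [List.ofFn_eq_map, Function.comp_def]
  have key (i j : ℕ) : I ^ i ⊓ J ^ j ≤ I ^ i * J ^ j := by
    have h := hz.pow_inf_pow_sup_le_mul (Finset.univ.map .inl) (Finset.univ.map .inr) ∅
      (Finset.disjoint_map_inl_map_inr _ _) (by simp) (by simp) i j
    simpa [← Set.range_comp, Function.comp_def, ← hI, ← hJ] using h
  refine ⟨fun i j ↦ isZero_tor_one_quotient (key i j), isZero_tor_one_quotient ?_⟩
  simpa using key 1 1
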